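/- arXiv:1103.1097 — 2 statements merged into one kernel-verified Lean document; each statement's English description precedes it below -/
import Mathlib

section
/- (Lemma 2.2: H² approximation by compactly supported functions for domains with corner-type boundary.) Let D ⊆ ℝⁿ be open and suppose that for every x₀ ∈ ∂D there are an open neighborhood U of x₀ and smooth functions y, z : U → ℝ, with non-vanishing differential at every point of {y = 0} ∩ U and of {z = 0} ∩ U respectively, such that D ∩ U is the interior of {y ≥ 0} ∩ {z ≥ 0} ∩ U, and such that if {y = 0} ∩ U and {z = 0} ∩ U intersect, then ({y = 0} ∖ {z = 0}) ∩ U is dense in {y = 0} ∩ U. Let u : ℝⁿ → ℝ be a C² function with compact support which vanishes identically outside D (so u is the extension by zero of a C² function on the closure of D with zero Cauchy data on ∂D). Then there is a sequence (u_k) of C² functions, each with compact support contained in D, such that u_k → u, all first-order partial derivatives ∂u_k → ∂u, and all second-order partial derivatives ∂²u_k → ∂²u in L²(ℝⁿ); that is, u can be approximated in the H²(ℝⁿ) norm by C² functions compactly supported in D. -/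
open Set MeasureTheory Filter
noncomputable section

/-- `ℝⁿ` as Euclidean space. -/
abbrev E (n : ℕ) := EuclideanSpace ℝ (Fin n)

/-- Partial derivative of `f` in the `i`-th coordinate direction. -/
def pd {n : ℕ} (i : Fin n) (f : E n → ℝ) (x : E n) : ℝ :=
  fderiv ℝ f x (EuclideanSpace.single i 1)

open scoped Convolution Pointwise

section Calculus

variable {n : ℕ}

lemma contDiff_pd {m k : ℕ∞} {f : E n → ℝ} (hf : ContDiff ℝ m f) (hk : k + 1 ≤ m) (i : Fin n) :
    ContDiff ℝ k (pd i f) :=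
  (hf.fderiv_right (by exact_mod_cast hk)).clm_apply contDiff_const

lemma tsupport_pd_subset (i : Fin n) (f : E n → ℝ) : tsupport (pd i f) ⊆ tsupport f := by
  refine (closure_mono fun x hx => ?_).trans (tsupport_fderiv_subset ℝ (f := f))
  rw [Function.mem_support] at hx ⊢
  intro h
  exact hx (by simp [pd, h])

lemma hasCompactSupport_pd {f : E n → ℝ} (hf : HasCompactSupport f) (i : Fin n) :
    HasCompactSupport (pd i f) :=
  hf.of_isClosed_subset (isClosed_tsupport _) (tsupport_pd_subset i f)

/-- Scalar convolution on `ℝⁿ`. -/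
def conv (f g : E n → ℝ) : E n → ℝ :=
  f ⋆[ContinuousLinearMap.lsmul ℝ ℝ, volume] g

lemma conv_comm (f g : E n → ℝ) : conv f g = conv g f := by
  unfold conv
  rw [← convolution_flip]
  congr 1
  ext
  simp

lemma pd_conv_right {f g : E n → ℝ} (hf : LocallyIntegrable f) (hg : ContDiff ℝ 1 g)
    (hgc : HasCompactSupport g) (i : Fin n) : pd i (conv f g) = conv f (pd i g) := by
  ext x
  unfold pd conv
  rw [(hgc.hasFDerivAt_convolution_right _ hf hg x).fderiv,
    convolution_precompR_apply _ hf (hgc.fderiv ℝ) (hg.continuous_fderiv one_ne_zero)]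

lemma pd_conv_left {f g : E n → ℝ} (hg : LocallyIntegrable g) (hf : ContDiff ℝ 1 f)
    (hfc : HasCompactSupport f) (i : Fin n) : pd i (conv f g) = conv (pd i f) g := by
  rw [conv_comm f, pd_conv_right hg hf hfc, conv_comm]

lemma conv_add_right {f g h : E n → ℝ} (hf : Continuous f) (hfc : HasCompactSupport f)
    (hg : LocallyIntegrable g) (hh : LocallyIntegrable h) :
    conv f (g + h) = conv f g + conv f h :=
  ConvolutionExists.distrib_add (hfc.convolutionExists_left _ hf hg)
    (hfc.convolutionExists_left _ hf hh)

lemma abs_conv_le {f g : E n → ℝ} {M : ℝ} (hf : Integrable f) (hg : ∀ x, |g x| ≤ M) (x : E n) :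
    |conv f g x| ≤ (∫ t, |f t|) * M := by
  rw [← integral_mul_const, ← Real.norm_eq_abs]
  unfold conv
  rw [convolution_def]
  refine norm_integral_le_of_norm_le (hf.abs.mul_const M) (Eventually.of_forall fun t => ?_)
  simp only [ContinuousLinearMap.lsmul_apply, smul_eq_mul, norm_mul, Real.norm_eq_abs]
  gcongr
  exact hg _

/-- The `L¹`-normalized dilation `x ↦ ε⁻ⁿ f (x / ε)`. -/
def dilate (ε : ℝ) (f : E n → ℝ) (x : E n) : ℝ := (ε ^ n)⁻¹ * f (ε⁻¹ • x)

lemma pd_dilate (ε : ℝ) (f : E n → ℝ) (i : Fin n) :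
    pd i (dilate ε f) = ε⁻¹ • dilate ε (pd i f) := by
  ext x
  have h : fderiv ℝ (dilate ε f) x = (ε ^ n)⁻¹ • fderiv ℝ (fun y => f (ε⁻¹ • y)) x :=
    congrFun (fderiv_const_smul_field (𝕜 := ℝ) (f := fun y => f (ε⁻¹ • y)) (ε ^ n)⁻¹) x
  rw [pd, h, fderiv_comp_smul]
  simp only [pd, dilate, _root_.smul_apply, smul_eq_mul, Pi.smul_apply]
  ring

lemma pd_const_smul (c : ℝ) (f : E n → ℝ) (i : Fin n) : pd i (c • f) = c • pd i f := by
  ext x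
  have h : fderiv ℝ (c • f) x = c • fderiv ℝ f x :=
    congrFun (fderiv_const_smul_field (𝕜 := ℝ) (f := f) c) x
  simp [pd, h]

lemma integral_dilate {ε : ℝ} (hε : 0 < ε) (f : E n → ℝ) : ∫ x, dilate ε f x = ∫ x, f x := by
  have h := Measure.integral_comp_inv_smul_of_nonneg (volume : Measure (E n)) f hε.le
  simp only [dilate]
  rw [integral_const_mul, h]
  simp only [finrank_euclideanSpace, Fintype.card_fin, smul_eq_mul]
  field_simp

lemma integral_abs_dilate {ε : ℝ} (hε : 0 < ε) (f : E n → ℝ) :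
    ∫ x, |dilate ε f x| = ∫ x, |f x| := by
  rw [← integral_dilate hε fun x => |f x|]
  congr 1 with x
  rw [dilate, dilate, abs_mul, abs_of_nonneg (by positivity)]

lemma contDiff_dilate {m : ℕ∞} {f : E n → ℝ} (hf : ContDiff ℝ m f) (ε : ℝ) :
    ContDiff ℝ m (dilate ε f) :=
  contDiff_const.mul (hf.comp (contDiff_const_smul _))

/-- A `C²` function vanishing to first order at `p`, with Hessian bounded by `η` on a ball
around `p`, is bounded by `η r²` on that ball. -/
lemma abs_le_of_fderiv_fderiv_le {u : E n → ℝ} (hu : ContDiff ℝ 2 u) {p : E n} {r η : ℝ}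
    (h0 : u p = 0) (h1 : fderiv ℝ u p = 0) (hη : 0 ≤ η)
    (h2 : ∀ x ∈ Metric.ball p r, ‖fderiv ℝ (fderiv ℝ u) x‖ ≤ η) {x : E n}
    (hx : x ∈ Metric.ball p r) : |u x| ≤ η * r ^ 2 := by
  have hr : 0 < r := Metric.pos_of_mem_ball hx
  have hp : p ∈ Metric.ball p r := Metric.mem_ball_self hr
  have hdu : Differentiable ℝ (fderiv ℝ u) :=
    (hu.fderiv_right (m := 1) (by norm_num)).differentiable one_ne_zero
  have hg : ∀ y ∈ Metric.ball p r, ‖fderiv ℝ u y‖ ≤ η * r := by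
    intro y hy
    have h := (convex_ball p r).norm_image_sub_le_of_norm_fderiv_le
      (fun z _ => hdu z) h2 hp hy
    rw [h1, sub_zero] at h
    refine h.trans ?_
    gcongr
    exact (mem_ball_iff_norm.1 hy).le
  have h := (convex_ball p r).norm_image_sub_le_of_norm_fderiv_le
    (fun z _ => hu.differentiable two_ne_zero z) hg hp hx
  rw [h0, sub_zero, Real.norm_eq_abs] at h
  refine h.trans ?_
  rw [sq, ← mul_assoc]
  gcongr
  exact (mem_ball_iff_norm.1 hx).le

/-- A compactly supported `C²` function whose derivatives of order at most two vanish on `F`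
is `o(dist(·, F)²)`, uniformly. -/
lemma exists_forall_thickening_abs_le {u : E n → ℝ} (hu : ContDiff ℝ 2 u)
    (hucpt : HasCompactSupport u) {F : Set (E n)} (h0 : ∀ p ∈ F, u p = 0)
    (h1 : ∀ p ∈ F, fderiv ℝ u p = 0) (h2 : ∀ p ∈ F, fderiv ℝ (fderiv ℝ u) p = 0)
    {η : ℝ} (hη : 0 < η) :
    ∃ r₀ > 0, ∀ r ≤ r₀, ∀ x ∈ Metric.thickening r F, |u x| ≤ η * r ^ 2 := by
  have hc : Continuous (fderiv ℝ (fderiv ℝ u)) :=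
    (hu.fderiv_right (m := 1) (by norm_num)).continuous_fderiv one_ne_zero
  have huc : UniformContinuous (fderiv ℝ (fderiv ℝ u)) :=
    ((hucpt.fderiv ℝ).fderiv ℝ).uniformContinuous_of_continuous hc
  obtain ⟨r₀, hr₀, H⟩ := (Metric.uniformContinuous_iff
    (f := fderiv ℝ (fderiv ℝ u))).1 huc η hη
  refine ⟨r₀, hr₀, fun r hr x hx => ?_⟩
  obtain ⟨p, hp, hxp⟩ := Metric.mem_thickening_iff.1 hx
  refine abs_le_of_fderiv_fderiv_le hu (h0 p hp) (h1 p hp) hη.le (fun y hy => ?_)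
    (Metric.mem_ball.2 hxp)
  have h := H ((Metric.mem_ball.1 hy).trans_le hr)
  rw [h2 p hp] at h
  exact (dist_zero_right (fderiv ℝ (fderiv ℝ u) y)).ge.trans h.le

end Calculus

section Approximation

variable {n : ℕ}

lemma eventually_abs_conv_sub_le {g : E n → ℝ} (hg : Continuous g) (hgc : HasCompactSupport g)
    {δ : ℝ} (hδ : 0 < δ) :
    ∀ᶠ ε in nhdsWithin (0 : ℝ) (Ioi 0), ∀ ρ : E n → ℝ,
      Function.support ρ ⊆ Metric.ball 0 ε → (∀ x, 0 ≤ ρ x) → ∫ x, ρ x = 1 →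
      ∀ x, |conv ρ g x - g x| ≤ δ := by
  obtain ⟨r, hr, H⟩ := Metric.uniformContinuous_iff.1
    (hgc.uniformContinuous_of_continuous hg) δ hδ
  filter_upwards [Ioo_mem_nhdsGT hr] with ε hε ρ hs hpos hint x
  exact dist_convolution_le hδ.le hs hpos hint hg.aestronglyMeasurable
    fun y hy => (H ((Metric.mem_ball.1 hy).trans hε.2)).le

lemma support_conv_subset {ρ w : E n → ℝ} {F K : Set (E n)} {ε : ℝ}
    (hρ : Function.support ρ ⊆ Metric.ball 0 ε) (hwK : Function.support w ⊆ K)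
    (hwF : Disjoint (Function.support w) (Metric.thickening (2 * ε) F)) :
    Function.support (conv ρ w) ⊆ Metric.cthickening ε K ∩ (Metric.thickening ε F)ᶜ := by
  intro x hx
  obtain ⟨t, ht, s, hs, rfl⟩ := Set.mem_add.1 (support_convolution_subset _ hx)
  have htε : ‖t‖ < ε := mem_ball_zero_iff.1 (hρ ht)
  refine ⟨Metric.mem_cthickening_of_dist_le _ s _ _ (hwK hs) (by simpa using htε.le), fun hF => ?_⟩
  obtain ⟨p, hp, hd⟩ := Metric.mem_thickening_iff.1 hF
  refine hwF.notMem_of_mem_left hs (Metric.mem_thickening_iff.2 ⟨p, hp, ?_⟩)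
  have : dist s p ≤ dist s (t + s) + dist (t + s) p := dist_triangle _ _ _
  have h2 : dist s (t + s) = ‖t‖ := by simp
  linarith

/-- A compactly supported `C²` function whose derivatives of order at most two vanish off the
open set `D` is a uniform `C²` limit of `C²` functions compactly supported in `D`. -/
lemma exists_uniform_approximation {D : Set (E n)} {u : E n → ℝ}
    (hu : ContDiff ℝ 2 u) (hucpt : HasCompactSupport u) (h0 : ∀ p ∉ D, u p = 0)
    (h1 : ∀ p ∉ D, fderiv ℝ u p = 0) (h2 : ∀ p ∉ D, fderiv ℝ (fderiv ℝ u) p = 0)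
    {δ : ℝ} (hδ : 0 < δ) :
    ∃ v : E n → ℝ, ContDiff ℝ 2 v ∧ tsupport v ⊆ D ∧
      tsupport v ⊆ Metric.cthickening 1 (tsupport u) ∧
      (∀ x, |v x - u x| ≤ δ) ∧ (∀ i x, |pd i v x - pd i u x| ≤ δ) ∧
      ∀ i j x, |pd i (pd j v) x - pd i (pd j u) x| ≤ δ := by
  let b : ContDiffBump (0 : E n) := ⟨1 / 2, 1, by norm_num, by norm_num⟩
  let φ : E n → ℝ := b.normed volume
  have hφ : ContDiff ℝ (2 : ℕ∞) φ := b.contDiff_normed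
  have hφc : HasCompactSupport φ := b.hasCompactSupport_normed
  have hφint : ∫ x, φ x = 1 := b.integral_normed
  have hφpos : ∀ x, 0 ≤ φ x := b.nonneg_normed
  have hφs : Function.support φ = Metric.ball 0 1 := b.support_normed_eq
  obtain ⟨C, hC, hC0, hC1, hC2⟩ : ∃ C > 0, (∫ x, |φ x|) ≤ C ∧
      (∀ i, ∫ x, |pd i φ x| ≤ C) ∧ ∀ i j, ∫ x, |pd i (pd j φ) x| ≤ C := by
    obtain ⟨a, ha⟩ := (finite_range fun i => ∫ x, |pd i φ x|).bddAbove
    obtain ⟨c, hc⟩ := (finite_range fun q : Fin n × Fin n =>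
      ∫ x, |pd q.1 (pd q.2 φ) x|).bddAbove
    refine ⟨max 1 (max (∫ x, |φ x|) (max a c)), by positivity, by simp, fun i => ?_,
      fun i j => ?_⟩
    · have := ha (mem_range_self i)
      simp only [le_max_iff]
      tauto
    · have := hc (mem_range_self (i, j))
      simp only [le_max_iff]
      tauto
  have hu' : ContDiff ℝ (2 : ℕ∞) u := hu
  have hu1 (j) : ContDiff ℝ (1 : ℕ∞) (pd j u) := contDiff_pd hu' (by norm_num) j
  have hu2 (i j) : ContDiff ℝ (0 : ℕ∞) (pd i (pd j u)) := contDiff_pd (hu1 j) (by norm_num) i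
  obtain ⟨r₀, hr₀, Hr⟩ := exists_forall_thickening_abs_le hu hucpt (F := Dᶜ) h0 h1 h2
    (η := δ / (8 * C)) (by positivity)
  have hev : ∀ᶠ ε in nhdsWithin (0 : ℝ) (Ioi 0), ε ∈ Ioo 0 (min 1 (r₀ / 2)) :=
    Ioo_mem_nhdsGT (by positivity)
  obtain ⟨ε, ⟨hε, hεr⟩, hm0, hm1, hm2⟩ := (hev.and <|
    (eventually_abs_conv_sub_le hu.continuous hucpt (half_pos hδ)).and <|
    (eventually_all.2 fun i => eventually_abs_conv_sub_le (hu1 i).continuous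
      (hasCompactSupport_pd hucpt i) (half_pos hδ)).and <|
    eventually_all.2 fun i => eventually_all.2 fun j => eventually_abs_conv_sub_le
      (hu2 i j).continuous (hasCompactSupport_pd (hasCompactSupport_pd hucpt j) i)
      (half_pos hδ)).exists
  have hε1 : ε < 1 := hεr.trans_le (min_le_left _ _)
  have hε2 : 2 * ε ≤ r₀ := by linarith [min_le_right 1 (r₀ / 2)]
  let T := Metric.thickening (2 * ε) Dᶜ
  have hT : MeasurableSet T := Metric.isOpen_thickening.measurableSet
  let r : E n → ℝ := T.indicator u
  let w : E n → ℝ := Tᶜ.indicator u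
  have huI : Integrable u := hu.continuous.integrable_of_hasCompactSupport hucpt
  have hr : LocallyIntegrable r := (huI.indicator hT).locallyIntegrable
  have hw : LocallyIntegrable w := (huI.indicator hT.compl).locallyIntegrable
  have hwr : w + r = u := indicator_compl_add_self T u
  have hrM : ∀ x, |r x| ≤ δ / (8 * C) * (2 * ε) ^ 2 := by
    intro x
    by_cases hx : x ∈ T
    · simpa only [r, indicator_of_mem hx] using Hr _ hε2 x hx
    · simp only [r, indicator_of_notMem hx, abs_zero]
      positivity
  let ρ : E n → ℝ := dilate ε φ
  have hρ : ContDiff ℝ (2 : ℕ∞) ρ := contDiff_dilate hφ ε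
  have hρs : Function.support ρ ⊆ Metric.ball 0 ε := by
    intro x hx
    have hx' : ε⁻¹ • x ∈ Function.support φ := fun h => hx (by simp [ρ, dilate, h])
    rw [hφs, mem_ball_zero_iff, norm_smul, Real.norm_of_nonneg (by positivity)] at hx'
    rw [mem_ball_zero_iff]
    rwa [inv_mul_lt_iff₀ hε, mul_one] at hx'
  have hρc : HasCompactSupport ρ := HasCompactSupport.of_support_subset_isCompact
    (isCompact_closedBall 0 ε) (hρs.trans Metric.ball_subset_closedBall)
  have hρpos : ∀ x, 0 ≤ ρ x := fun x => mul_nonneg (by positivity) (hφpos _)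
  have hρint : ∫ x, ρ x = 1 := (integral_dilate hε φ).trans hφint
  have hρ1 (j) : ContDiff ℝ (1 : ℕ∞) (pd j ρ) := contDiff_pd hρ (by norm_num) j
  have hρc1 (j) : HasCompactSupport (pd j ρ) := hasCompactSupport_pd hρc j
  have hρ2 (i j) : ContDiff ℝ (0 : ℕ∞) (pd i (pd j ρ)) := contDiff_pd (hρ1 j) (by norm_num) i
  have hρc2 (i j) : HasCompactSupport (pd i (pd j ρ)) := hasCompactSupport_pd (hρc1 j) i
  have hρ' : ContDiff ℝ 1 ρ := hρ.of_le (by norm_num)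
  have key : ∀ {Q g : E n → ℝ}, Continuous Q → HasCompactSupport Q →
      (∫ t, |Q t|) ≤ (ε ^ 2)⁻¹ * C → conv Q u = conv ρ g → (∀ x, |conv ρ g x - g x| ≤ δ / 2) →
      ∀ x, |conv Q w x - g x| ≤ δ := by
    intro Q g hQ hQc hQC hQg hg x
    have h := congrFun (conv_add_right hQ hQc hw hr) x
    rw [hwr, hQg, Pi.add_apply] at h
    have hle : |conv Q r x| ≤ δ / 2 := by
      refine (abs_conv_le (hQ.integrable_of_hasCompactSupport hQc) hrM x).trans ?_
      refine (mul_le_mul_of_nonneg_right hQC (by positivity)).trans_eq ?_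
      field_simp
      norm_num
    have hgx := hg x
    rw [abs_le] at *
    constructor <;> linarith
  have hpow : 1 ≤ (ε ^ 2)⁻¹ := (one_le_inv₀ (by positivity)).2 (pow_le_one₀ hε.le hε1.le)
  have hinv : ε⁻¹ ≤ (ε ^ 2)⁻¹ := inv_anti₀ (by positivity) (by nlinarith)
  have hv1 (j) : pd j (conv ρ w) = conv (pd j ρ) w := pd_conv_left hw hρ' hρc j
  have hv2 (i j) : pd i (pd j (conv ρ w)) = conv (pd i (pd j ρ)) w := by
    rw [hv1, pd_conv_left hw (hρ1 j) (hρc1 j)]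
  have hρu (j) : conv (pd j ρ) u = conv ρ (pd j u) := by
    rw [← pd_conv_left huI.locallyIntegrable hρ' hρc,
      pd_conv_right hρ.continuous.locallyIntegrable (hu.of_le (by norm_num)) hucpt]
  have hsub : tsupport (conv ρ w) ⊆
      Metric.cthickening ε (tsupport u) ∩ (Metric.thickening ε Dᶜ)ᶜ := by
    refine closure_minimal (support_conv_subset hρs ?_ ?_)
      (Metric.isClosed_cthickening.inter Metric.isOpen_thickening.isClosed_compl)
    · rw [support_indicator]
      exact inter_subset_right.trans (subset_tsupport u)
    · rw [support_indicator]
      exact disjoint_compl_left.mono_left inter_subset_left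
  refine ⟨conv ρ w, hρc.contDiff_convolution_left _ hρ hw, fun x hx => ?_, ?_,
    key hρ.continuous hρc ?_ rfl (hm0 ρ hρs hρpos hρint), fun i => ?_, fun i j => ?_⟩
  · by_contra hxD
    exact (hsub hx).2 (Metric.self_subset_thickening hε _ hxD)
  · exact (hsub.trans inter_subset_left).trans (Metric.cthickening_mono hε1.le _)
  · rw [integral_abs_dilate hε]
    exact hC0.trans (le_mul_of_one_le_left hC.le hpow)
  · rw [hv1]
    refine key (hρ1 i).continuous (hρc1 i) ?_ (hρu i) (hm1 i ρ hρs hρpos hρint)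
    simp only [ρ, pd_dilate, Pi.smul_apply, smul_eq_mul, abs_mul, integral_const_mul,
      integral_abs_dilate hε, abs_of_pos (inv_pos.2 hε)]
    exact mul_le_mul hinv (hC1 i) (integral_nonneg fun _ => abs_nonneg _) (by positivity)
  · rw [hv2]
    refine key (hρ2 i j).continuous (hρc2 i j) ?_ ?_ (hm2 i j ρ hρs hρpos hρint)
    · simp only [ρ, pd_dilate, pd_const_smul, Pi.smul_apply, smul_eq_mul, abs_mul,
        integral_const_mul, integral_abs_dilate hε, abs_of_pos (inv_pos.2 hε)]
      rw [← mul_assoc, ← mul_inv, ← sq]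
      exact mul_le_mul_of_nonneg_left (hC2 i j) (by positivity)
    · rw [← pd_conv_left huI.locallyIntegrable (hρ1 j) (hρc1 j), hρu,
        pd_conv_right hρ.continuous.locallyIntegrable (hu1 j) (hasCompactSupport_pd hucpt j)]

lemma integral_sq_le_of_abs_le {f : E n → ℝ} {K : Set (E n)} (hK : IsCompact K) {δ : ℝ}
    (hf : ∀ x, |f x| ≤ δ) (hfK : ∀ x ∉ K, f x = 0) :
    ∫ x, f x ^ 2 ≤ δ ^ 2 * volume.real K := by
  rw [← setIntegral_eq_integral_of_forall_compl_eq_zero (s := K) fun x hx => by simp [hfK x hx]]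
  refine (Real.le_norm_self _).trans (norm_setIntegral_le_of_norm_le_const hK.measure_lt_top
    fun x _ => ?_)
  rw [norm_pow, Real.norm_eq_abs]
  exact pow_le_pow_left₀ (abs_nonneg _) (hf x) 2

lemma tendsto_integral_sq_sub {v : ℕ → E n → ℝ} {u : E n → ℝ} {K : Set (E n)} (hK : IsCompact K)
    (hv : ∀ k x, |v k x - u x| ≤ 1 / ((k : ℝ) + 1)) (hvK : ∀ k, tsupport (v k) ⊆ K)
    (huK : tsupport u ⊆ K) :
    Tendsto (fun k => ∫ x, (v k x - u x) ^ 2) atTop (nhds 0) := by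
  have hlim : Tendsto (fun k : ℕ => (1 / ((k : ℝ) + 1)) ^ 2 * volume.real K) atTop (nhds 0) := by
    simpa using (tendsto_one_div_add_atTop_nhds_zero_nat.pow 2).mul_const (volume.real K)
  refine squeeze_zero (fun k => integral_nonneg fun x => sq_nonneg _) (fun k => ?_) hlim
  refine integral_sq_le_of_abs_le hK (hv k) fun x hx => ?_
  rw [image_eq_zero_of_notMem_tsupport fun h => hx (hvK k h),
    image_eq_zero_of_notMem_tsupport fun h => hx (huK h), sub_zero]

end Approximation

/-- If `D` is locally the interior of a set whose complement is relatively open, then every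
point off `D` is a limit of exterior points. -/
lemma compl_subset_closure_interior_compl {X : Type*} [TopologicalSpace X] {D : Set X}
    (h : ∀ x ∈ frontier D, ∃ U S : Set X, IsOpen U ∧ x ∈ U ∧ IsOpen (U \ S) ∧
      D ∩ U = interior S) :
    Dᶜ ⊆ closure (interior Dᶜ) := by
  intro x hx
  by_cases hxD : x ∈ closure D
  · obtain ⟨U, S, hU, hxU, hUS, hDU⟩ := h x ⟨hxD, fun hi => hx (interior_subset hi)⟩
    have hxS : x ∈ closure Sᶜ := by
      rw [closure_compl, ← hDU]
      exact fun hx' => hx hx'.1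
    refine closure_mono (interior_maximal (fun z hz hzD => hz.2 ?_) hUS)
      (hU.inter_closure ⟨hxU, hxS⟩)
    exact interior_subset (hDU ▸ ⟨hzD, hz.1⟩)
  · exact subset_closure (by rwa [interior_compl])

lemma fderiv_eq_zero_of_mem_closure_interior {X Y : Type*} [NormedAddCommGroup X]
    [NormedSpace ℝ X] [NormedAddCommGroup Y] [NormedSpace ℝ Y] {f : X → Y} {F : Set X}
    (hf : ContDiff ℝ 1 f) (h0 : ∀ x ∈ interior F, f x = 0) {x : X}
    (hx : x ∈ closure (interior F)) : fderiv ℝ f x = 0 := by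
  have hsub : interior F ⊆ {z | fderiv ℝ f z = 0} := by
    intro z hz
    have : f =ᶠ[nhds z] fun _ => 0 := by
      filter_upwards [isOpen_interior.mem_nhds hz] with t ht using h0 t ht
    simp [this.fderiv_eq]
  exact closure_minimal hsub
    (isClosed_eq (hf.continuous_fderiv one_ne_zero) continuous_const) hx

/-- Lemma 2.2: Let `D ⊆ ℝⁿ` be open, locally of the form `{y ≥ 0} ∩ {z ≥ 0}` near each
boundary point, with the density condition on `{y = 0} ∖ {z = 0}`.  Then every compactly
supported `C²` function vanishing outside `D` can be approximated in `H²(ℝⁿ)` by `C²`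
functions compactly supported in `D`. -/
theorem H2_approximation_corner_domain
    {n : ℕ} (hn : 1 ≤ n)
    (D : Set (E n)) (hD : IsOpen D)
    (hbdry : ∀ x₀ ∈ frontier D, ∃ (U : Set (E n)) (y z : E n → ℝ),
      IsOpen U ∧ x₀ ∈ U ∧
      ContDiff ℝ (⊤ : ℕ∞) y ∧ ContDiff ℝ (⊤ : ℕ∞) z ∧
      (∀ x ∈ U, y x = 0 → fderiv ℝ y x ≠ 0) ∧
      (∀ x ∈ U, z x = 0 → fderiv ℝ z x ≠ 0) ∧
      D ∩ U = interior {x ∈ U | 0 ≤ y x ∧ 0 ≤ z x} ∧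
      ((∃ x ∈ U, y x = 0 ∧ z x = 0) →
        {x ∈ U | y x = 0} ⊆ closure {x ∈ U | y x = 0 ∧ z x ≠ 0}))
    (u : E n → ℝ) (hu : ContDiff ℝ 2 u) (hucpt : HasCompactSupport u)
    (huD : ∀ x, x ∉ D → u x = 0) :
    ∃ v : ℕ → E n → ℝ,
      (∀ k, ContDiff ℝ 2 (v k) ∧ HasCompactSupport (v k) ∧ tsupport (v k) ⊆ D) ∧
      Tendsto (fun k => ∫ x, (v k x - u x) ^ 2) atTop (nhds 0) ∧
      (∀ i : Fin n,
        Tendsto (fun k => ∫ x, (pd i (v k) x - pd i u x) ^ 2) atTop (nhds 0)) ∧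
      (∀ i j : Fin n,
        Tendsto (fun k => ∫ x, (pd i (pd j (v k)) x - pd i (pd j u) x) ^ 2) atTop
          (nhds 0)) := by
  have hcl : Dᶜ ⊆ closure (interior Dᶜ) := by
    refine compl_subset_closure_interior_compl fun x hx => ?_
    obtain ⟨U, y, z, hU, hxU, hy, hz, -, -, hDU, -⟩ := hbdry x hx
    refine ⟨U, _, hU, hxU, ?_, hDU⟩
    have hset : U \ {x ∈ U | 0 ≤ y x ∧ 0 ≤ z x} = U ∩ ({x | y x < 0} ∪ {x | z x < 0}) := by
      ext t
      simp only [Set.mem_sdiff, mem_ofPred_eq, mem_inter_iff, mem_union, ← not_le]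
      tauto
    rw [hset]
    exact hU.inter ((isOpen_lt hy.continuous continuous_const).union
      (isOpen_lt hz.continuous continuous_const))
  have h1 : ∀ p ∉ D, fderiv ℝ u p = 0 := fun p hp =>
    fderiv_eq_zero_of_mem_closure_interior (hu.of_le (by norm_num))
      (fun x hx => huD x (interior_subset hx)) (hcl hp)
  have h2 : ∀ p ∉ D, fderiv ℝ (fderiv ℝ u) p = 0 := fun p hp =>
    fderiv_eq_zero_of_mem_closure_interior (hu.fderiv_right (by norm_num))
      (fun x hx => h1 x (interior_subset hx)) (hcl hp)
  choose v hv hvD hvK hv0 hv1 hv2 using fun k : ℕ =>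
    exists_uniform_approximation hu hucpt huD h1 h2 (Nat.one_div_pos_of_nat (α := ℝ) (n := k))
  have hK : IsCompact (Metric.cthickening 1 (tsupport u)) := hucpt.isCompact.cthickening
  have huK : tsupport u ⊆ Metric.cthickening 1 (tsupport u) := Metric.self_subset_cthickening _
  refine ⟨v, fun k => ⟨hv k, hK.of_isClosed_subset (isClosed_tsupport _) (hvK k), hvD k⟩,
    tendsto_integral_sq_sub hK hv0 hvK huK, fun i => ?_, fun i j => ?_⟩
  · exact tendsto_integral_sq_sub hK (fun k => hv1 k i)
      (fun k => (tsupport_pd_subset i _).trans (hvK k)) ((tsupport_pd_subset i _).trans huK)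
  · have hsub (f : E n → ℝ) : tsupport (pd i (pd j f)) ⊆ tsupport f :=
      (tsupport_pd_subset i _).trans (tsupport_pd_subset j f)
    exact tendsto_integral_sq_sub hK (fun k => hv2 k i j)
      (fun k => (hsub _).trans (hvK k)) ((hsub u).trans huK)
end
end

section
/- (Hadamard-type factorization used in the proof of Lemma 2.2.) Let U ⊆ ℝⁿ be open and let y, z : U → ℝ be smooth functions such that dy ≠ 0 at every point of {y = 0} and dz ≠ 0 at every point of {z = 0}, and such that {y = 0} ∖ {z = 0} is dense in {y = 0}. Let u : U → ℝ be a C² function which vanishes at every point of {z = 0} and at every point of {y = 0} ∖ {z = 0}. Then u vanishes at every point of {y = 0}, and for every x₀ ∈ {y = 0} ∩ {z = 0} there exist an open neighborhood V ⊆ U of x₀ and a continuous function v : V → ℝ such that u(x) = y(x) · z(x) · v(x) for all x ∈ V. -/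
open Set
noncomputable section

open Filter Topology MeasureTheory

/-- Integrating a jointly `C^k` function over a compact interval yields a `C^k` function of the
parameter. -/
theorem contDiff_parametric_intervalIntegral.{u} {X F : Type u}
    [NormedAddCommGroup X] [NormedSpace ℝ X] [FiniteDimensional ℝ X]
    [NormedAddCommGroup F] [NormedSpace ℝ F] (a b : ℝ) (k : ℕ) {h : X × ℝ → F}
    (hh : ContDiff ℝ k h) : ContDiff ℝ k fun x => ∫ t in a..b, h (x, t) := by
  induction k generalizing F with
  | zero =>
    simp only [CharP.cast_eq_zero, contDiff_zero] at hh ⊢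
    exact intervalIntegral.continuous_parametric_intervalIntegral_of_continuous'
      (f := fun x t => h (x, t)) hh a b
  | succ k ih =>
    have hh1 : ContDiff ℝ 1 h := hh.of_le (by exact_mod_cast Nat.le_add_left 1 k)
    set h' : X × ℝ → X →L[ℝ] F := fun q => (fderiv ℝ h q).comp (.inl ℝ X ℝ)
    have hh'k : ContDiff ℝ k h' :=
      (hh.fderiv_right (m := k) (by norm_cast)).clm_comp contDiff_const
    have hc : Continuous h' := hh'k.continuous
    rw [Nat.cast_succ, contDiff_succ_iff_hasFDerivAt]
    refine ⟨fun x => ∫ t in a..b, h' (x, t), ih hh'k, fun x₀ => ?_⟩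
    obtain ⟨C, hC⟩ := ((isCompact_closedBall x₀ 1).prod
      (isCompact_uIcc (a := a) (b := b))).exists_bound_of_continuousOn hc.continuousOn
    have hslice : ∀ x, Continuous fun t => h (x, t) := fun x =>
      hh.continuous.comp (Continuous.prodMk_right x)
    refine intervalIntegral.hasFDerivAt_integral_of_dominated_of_fderiv_le
      (F := fun x t => h (x, t)) (F' := fun x t => h' (x, t)) (bound := fun _ => C)
      (Metric.closedBall_mem_nhds x₀ one_pos)
      (Eventually.of_forall fun x => (hslice x).aestronglyMeasurable)
      ((hslice x₀).intervalIntegrable _ _)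
      (hc.comp (Continuous.prodMk_right x₀)).aestronglyMeasurable
      (Eventually.of_forall fun t ht x hx => hC (x, t) ⟨hx, uIoc_subset_uIcc ht⟩)
      intervalIntegrable_const
      (Eventually.of_forall fun t _ x _ => ?_)
    exact ((hh1.differentiable one_ne_zero (x, t)).hasFDerivAt).comp x
      (hasFDerivAt_prodMk_left x t)

/-- A `C^(k+1)` function vanishing on the kernel of a nonzero linear form `ℓ` is the product of `ℓ`
and a `C^k` function. -/
theorem ContDiff.exists_eq_clm_mul {X : Type}
    [NormedAddCommGroup X] [NormedSpace ℝ X] [FiniteDimensional ℝ X] {k : ℕ} {f : X → ℝ}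
    (hf : ContDiff ℝ (k + 1) f) {l : X →L[ℝ] ℝ} {w : X} (hw : l w = 1)
    (hfl : ∀ p, l p = 0 → f p = 0) :
    ∃ g : X → ℝ, ContDiff ℝ k g ∧ ∀ p, f p = l p * g p := by
  set c : X × ℝ → X := fun q => q.1 - ((1 - q.2) * l q.1) • w with hc
  have hcc : ContDiff ℝ (k + 1) c := by fun_prop
  refine ⟨fun p => ∫ t in (0 : ℝ)..1, fderiv ℝ f (c (p, t)) w,
    contDiff_parametric_intervalIntegral 0 1 k
      (h := fun q => fderiv ℝ f (c q) w) ?_, fun p => ?_⟩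
  · exact ((hf.fderiv_right le_rfl).comp (hcc.of_le (by exact_mod_cast Nat.le_succ k))).clm_apply
      contDiff_const
  · have hd : ∀ t, HasDerivAt (fun t => f (c (p, t))) (l p * fderiv ℝ f (c (p, t)) w) t := by
      intro t
      have h1 : HasDerivAt (fun t => c (p, t)) (l p • w) t := by
        have := ((((hasDerivAt_id t).const_sub 1).mul_const (l p)).smul_const w).const_sub p
        simpa [hc] using this
      have h2 := ((hf.differentiable (by simp)) (c (p, t))).hasFDerivAt.comp_hasDerivAt t h1
      rw [map_smul, smul_eq_mul] at h2
      exact h2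
    have hcont : Continuous fun t => l p * fderiv ℝ f (c (p, t)) w := by
      have h1 := hf.continuous_fderiv (by simp)
      have h2 := hcc.continuous
      fun_prop
    have := intervalIntegral.integral_eq_sub_of_hasDerivAt (a := 0) (b := 1) (fun t _ => hd t)
      (hcont.intervalIntegrable _ _)
    have h0 : f (c (p, 0)) = 0 := hfl _ (by simp [hc, hw])
    have h1 : c (p, 1) = p := by simp [hc]
    rw [intervalIntegral.integral_const_mul, h0, h1, sub_zero] at this
    exact this.symm

/-- Multiplying by a bump function extends the germ of a `C^k` function to a global `C^k`
function. -/
theorem ContDiffAt.exists_contDiff_bump_mul {X : Type*}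
    [NormedAddCommGroup X] [NormedSpace ℝ X] [FiniteDimensional ℝ X] {k : ℕ} {f : X → ℝ} {p : X}
    (hf : ContDiffAt ℝ k f p) {s : Set X} (hs : s ∈ 𝓝 p) :
    ∃ χ : X → ℝ, χ =ᶠ[𝓝 p] 1 ∧ (∀ x ∉ s, χ x = 0) ∧ ContDiff ℝ k fun x => χ x * f x := by
  have hS : s ∩ {x | ContDiffAt ℝ k f x} ∈ 𝓝 p :=
    inter_mem hs (hf.eventually (by simp))
  obtain ⟨r, hr, hrS⟩ := Metric.nhds_basis_closedBall.mem_iff.1 hS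
  let χ : ContDiffBump p := ⟨r / 2, r, half_pos hr, half_lt_self hr⟩
  refine ⟨χ, χ.eventuallyEq_one, fun x hx => ?_, contDiff_iff_contDiffAt.2 fun x => ?_⟩
  · refine χ.zero_of_le_dist (le_of_not_gt fun h => hx (hrS ?_).1)
    exact Metric.mem_closedBall.2 h.le
  · by_cases hx : x ∈ tsupport χ
    · rw [χ.tsupport_eq] at hx
      exact χ.contDiffAt.mul (hrS hx).2
    · refine (contDiffAt_const (c := 0)).congr_of_eventuallyEq ?_
      filter_upwards [notMem_tsupport_iff_eventuallyEq.1 hx] with x' hx'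
      simp [hx']

/-- **Hadamard's lemma**: near a point where `dz ≠ 0`, a `C^(k+1)` function vanishing on `{z = 0}`
is the product of `z` and a `C^k` function. -/
theorem ContDiffAt.exists_eventuallyEq_mul_of_fderiv_ne_zero {X : Type}
    [NormedAddCommGroup X] [NormedSpace ℝ X] [FiniteDimensional ℝ X] {k : ℕ} {f z : X → ℝ} {x₀ : X}
    (hf : ContDiffAt ℝ (k + 1) f x₀) (hz : ContDiffAt ℝ (k + 1) z x₀) (hdz : fderiv ℝ z x₀ ≠ 0)
    (hfz : ∀ᶠ x in 𝓝 x₀, z x = 0 → f x = 0) :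
    ∃ g : X → ℝ, ContDiffAt ℝ k g x₀ ∧ ∀ᶠ x in 𝓝 x₀, f x = z x * g x := by
  set l := fderiv ℝ z x₀
  obtain ⟨w, hw⟩ : ∃ w, l w = 1 := by
    obtain ⟨v, hv⟩ := DFunLike.ne_iff.1 hdz
    exact ⟨(l v)⁻¹ • v, by simpa using inv_mul_cancel₀ hv⟩
  -- `Φ` straightens `z`: it is a local diffeomorphism with `l ∘ Φ = z`.
  set Φ : X → X := fun x => x + (z x - l x) • w with hΦ
  have hlΦ : ∀ x, l (Φ x) = z x := fun x => by simp [hΦ, hw]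
  have hΦc : ContDiffAt ℝ (k + 1) Φ x₀ := by fun_prop
  have hΦd : HasFDerivAt Φ ((ContinuousLinearEquiv.refl ℝ X : X ≃L[ℝ] X) : X →L[ℝ] X) x₀ := by
    have h1 : HasFDerivAt z l x₀ := (hz.differentiableAt (by simp)).hasFDerivAt
    have := (hasFDerivAt_id x₀).add ((h1.sub l.hasFDerivAt).smul_const w)
    refine this.congr_fderiv ?_
    ext v; simp
  have hk : ((k : WithTop ℕ∞) + 1) ≠ 0 := by simp
  set φ := hΦc.toOpenPartialHomeomorph Φ hΦd hk
  have hx₀ : x₀ ∈ φ.source := hΦc.mem_toOpenPartialHomeomorph_source hΦd hk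
  have hp₀ : Φ x₀ ∈ φ.target := hΦc.image_mem_toOpenPartialHomeomorph_target hΦd hk
  have hinv : φ.symm (Φ x₀) = x₀ := φ.left_inv hx₀
  have hsymm : ContDiffAt ℝ (k + 1) φ.symm (Φ x₀) := hΦc.to_localInverse hΦd hk
  have hF : ContDiffAt ℝ (k + 1 : ℕ) (f ∘ φ.symm) (Φ x₀) := by
    push_cast
    exact ContDiffAt.comp _ (by rwa [hinv]) hsymm
  have hS : ∀ᶠ p in 𝓝 (Φ x₀), p ∈ φ.target ∧ (z (φ.symm p) = 0 → f (φ.symm p) = 0) :=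
    (φ.open_target.eventually_mem hp₀).and
      (hsymm.continuousAt.eventually (by rwa [hinv]))
  obtain ⟨χ, hχ1, hχ0, hχ⟩ := hF.exists_contDiff_bump_mul hS
  obtain ⟨g, hg, hfg⟩ := ContDiff.exists_eq_clm_mul (k := k) (by exact_mod_cast hχ) hw (by
    intro p hp
    by_cases hpS : p ∈ φ.target ∧ (z (φ.symm p) = 0 → f (φ.symm p) = 0)
    · have h1 : Φ (φ.symm p) = p := φ.right_inv hpS.1
      have h2 : z (φ.symm p) = 0 := by rw [← hlΦ, h1, hp]
      simp [hpS.2 h2]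
    · simp [hχ0 p hpS])
  refine ⟨g ∘ Φ, hg.contDiffAt.comp _ (hΦc.of_le (by exact_mod_cast Nat.le_succ k)), ?_⟩
  filter_upwards [hΦc.continuousAt.eventually hχ1, φ.open_source.mem_nhds hx₀] with x hx hxs
  have h1 : φ.symm (Φ x) = x := φ.left_inv hxs
  have h2 := hfg (Φ x)
  rw [hlΦ] at h2
  simpa [h1, hx] using h2

/-- Hadamard-type factorization used in the proof of Lemma 2.2: if `u ∈ C²(U)` vanishes
on `{z = 0}` and on `{y = 0} ∖ {z = 0}`, where `y`, `z` are smooth with non-degenerate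
zero sets and `{y = 0} ∖ {z = 0}` is dense in `{y = 0}`, then `u` vanishes on all of
`{y = 0}`, and near each common zero `x₀` of `y` and `z` one can factor
`u = y · z · v` with `v` continuous. -/
theorem hadamard_factorization
    {n : ℕ} (hn : 1 ≤ n)
    (U : Set (E n)) (hU : IsOpen U)
    (y z : E n → ℝ)
    (hy : ContDiffOn ℝ (⊤ : ℕ∞) y U) (hz : ContDiffOn ℝ (⊤ : ℕ∞) z U)
    (hdy : ∀ x ∈ U, y x = 0 → fderiv ℝ y x ≠ 0)
    (hdz : ∀ x ∈ U, z x = 0 → fderiv ℝ z x ≠ 0)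
    (hdense : {x ∈ U | y x = 0} ⊆ closure {x ∈ U | y x = 0 ∧ z x ≠ 0})
    (u : E n → ℝ) (hu : ContDiffOn ℝ 2 u U)
    (huz : ∀ x ∈ U, z x = 0 → u x = 0)
    (huy : ∀ x ∈ U, y x = 0 → z x ≠ 0 → u x = 0) :
    (∀ x ∈ U, y x = 0 → u x = 0) ∧
    (∀ x₀ ∈ U, y x₀ = 0 → z x₀ = 0 →
      ∃ V : Set (E n), IsOpen V ∧ x₀ ∈ V ∧ V ⊆ U ∧
        ∃ v : E n → ℝ, ContinuousOn v V ∧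
          ∀ x ∈ V, u x = y x * z x * v x) := by
  have hU' : ∀ x ∈ U, U ∈ 𝓝 x := fun x hx => hU.mem_nhds hx
  refine ⟨fun x hx hyx => ?_, fun x₀ hx₀ hyx₀ hzx₀ => ?_⟩
  · by_cases hzx : z x = 0
    exacts [huz x hx hzx, huy x hx hyx hzx]
  have hz2 : ContDiffAt ℝ ((1 : ℕ) + 1) z x₀ :=
    (hz.contDiffAt (hU' x₀ hx₀)).of_le (by norm_cast)
  have hy1 : ContDiffAt ℝ ((0 : ℕ) + 1) y x₀ :=
    (hy.contDiffAt (hU' x₀ hx₀)).of_le (by norm_cast)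
  have hu2 : ContDiffAt ℝ ((1 : ℕ) + 1) u x₀ :=
    (hu.contDiffAt (hU' x₀ hx₀)).of_le (by norm_num [one_add_one_eq_two])
  obtain ⟨u₁, hu₁, huu₁⟩ := hu2.exists_eventuallyEq_mul_of_fderiv_ne_zero hz2 (hdz x₀ hx₀ hzx₀)
    (eventually_of_mem (hU' x₀ hx₀) huz)
  have hu₁y : ∀ᶠ x in 𝓝 x₀, y x = 0 → u₁ x = 0 := by
    filter_upwards [hU' x₀ hx₀, huu₁.eventually_nhds, hu₁.eventually (by simp)]
      with x hxU hxu hxc hyx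
    by_contra hne
    obtain ⟨x', ⟨hx'U, hyx', hzx'⟩, hx'u, hx'ne⟩ :=
      ((mem_closure_iff_frequently.1 (hdense ⟨hxU, hyx⟩)).and_eventually
        (hxu.and (hxc.continuousAt.eventually_ne hne))).exists
    rw [huy x' hx'U hyx' hzx'] at hx'u
    exact mul_ne_zero hzx' hx'ne hx'u.symm
  obtain ⟨u₂, hu₂, huu₂⟩ := ContDiffAt.exists_eventuallyEq_mul_of_fderiv_ne_zero
    (by simpa using hu₁) hy1 (hdy x₀ hx₀ hyx₀) hu₁y
  obtain ⟨V, hV, hVo, hxV⟩ := eventually_nhds_iff.1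
    ((eventually_mem_nhds_iff.2 (hU' x₀ hx₀)).and
      (huu₁.and (huu₂.and (hu₂.eventually (by simp)))))
  refine ⟨V, hVo, hxV, fun x hx => mem_of_mem_nhds (hV x hx).1, u₂,
    fun x hx => (hV x hx).2.2.2.continuousAt.continuousWithinAt, fun x hx => ?_⟩
  obtain ⟨-, h1, h2, -⟩ := hV x hx
  rw [h1, h2]
  ring
end
end
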